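/- Let A = {1, b, c} with integers 1 < b < c, and set q = ⌊c/(b+1)⌋ and r = c mod (b+1). Then preper(A) > 0 if and only if b is even, c > b + 1, and r is even with r < b − 2. Moreover, in that case, setting γ = (b − r − 2)/2, we have preper(A) = min(q, γ)·(b + c + 2) − b − 1, and per(A) = c + 1 if γ < q, per(A) = b + c if q < γ, and per(A) = b − 1 if q = γ. -/

import Mathlib

open Classical in
/-- The winning sequence on ℕ, where `seed` gives values at negative positions. -/
noncomputable def subW (A : Set ℕ) (seed : ℤ → ℕ) : ℕ → ℕ := fun n =>
  Nat.strongRecOn n (fun n ih =>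
    if ∃ x ∈ A, (if h : 0 < x ∧ x ≤ n then ih (n - x) (by omega)
                 else seed ((n : ℤ) - (x : ℤ))) = 0
    then 1 else 0)

/-- The winning sequence `w^{A,seed} : ℤ → ℕ`. -/
noncomputable def W (A : Set ℕ) (seed : ℤ → ℕ) : ℤ → ℕ := fun n =>
  if 0 ≤ n then subW A seed n.toNat else seed n

/-- The trivial seed (all ones), giving the unseeded sequence `w^A`. -/
def one : ℤ → ℕ := fun _ => 1

/-- The seed function determined by a string `S ∈ {0,1}^L`: `w(-i) = S_i` for `1 ≤ i ≤ L`,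
and `w(n) = 1` for `n < -L`. -/
def seedExt (L : ℕ) (S : ℕ → Bool) : ℤ → ℕ := fun j =>
  if -(L : ℤ) ≤ j ∧ j < 0 then (if S ((-j).toNat - 1) then 1 else 0) else 1

/-- `w` is eventually periodic over `p`. -/
def PeriodicOver (w : ℤ → ℕ) (p : ℕ) : Prop :=
  ∃ N : ℕ, ∀ n : ℤ, (N : ℤ) ≤ n → w n = w (n + p)

/-- The (eventual) period: the least `p ≥ 1` over which `w` is eventually periodic. -/
noncomputable def per (w : ℤ → ℕ) : ℕ := sInf {p : ℕ | 0 < p ∧ PeriodicOver w p}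

/-- The preperiod: the least `N` that works for `p = per w`. -/
noncomputable def preper (w : ℤ → ℕ) : ℕ :=
  sInf {N : ℕ | ∀ n : ℤ, (N : ℤ) ≤ n → w n = w (n + per w)}

/-- `Z` is the zero set of the unseeded winning sequence of `{1, b, c}`. -/
structure IsZeroSet (b c : ℤ) (Z : ℤ → Prop) : Prop where
  neg : ∀ n < 0, ¬ Z n
  iff : ∀ n, 0 ≤ n → (Z n ↔ ¬ Z (n - 1) ∧ ¬ Z (n - b) ∧ ¬ Z (n - c))

lemma subW_eq (A : Set ℕ) (seed : ℤ → ℕ) (n : ℕ) :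
    subW A seed n = open Classical in
      if ∃ x ∈ A, (if 0 < x ∧ x ≤ n then subW A seed (n - x)
        else seed ((n : ℤ) - (x : ℤ))) = 0 then 1 else 0 := by
  rw [subW, Nat.strongRecOn_eq]
  simp only [dite_eq_ite]
  rfl

lemma W_le_one (A : Set ℕ) (n : ℤ) : W A one n ≤ 1 := by
  unfold W
  split_ifs
  · rw [subW_eq]
    split_ifs <;> simp
  · simp [one]

lemma W_congr_iff (A : Set ℕ) (m n : ℤ) :
    W A one m = W A one n ↔ (W A one m = 0 ↔ W A one n = 0) := by
  have h1 := W_le_one A m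
  have h2 := W_le_one A n
  omega

lemma isZeroSet_W (b c : ℕ) (hb : 0 < b) (hc : 0 < c) :
    IsZeroSet b c (fun n => W {1, b, c} one n = 0) where
  neg n hn := by simp [W, one, not_le.mpr hn]
  iff n hn := by
    obtain ⟨k, rfl⟩ := Int.eq_ofNat_of_zero_le hn
    have key : ∀ x : ℕ, 0 < x → ((if 0 < x ∧ x ≤ k then subW {1, b, c} one (k - x)
        else one ((k : ℤ) - (x : ℤ))) = W {1, b, c} one ((k : ℤ) - x)) := by
      intro x hx
      unfold W
      by_cases hxk : x ≤ k
      · have h1 : ((k : ℤ) - x).toNat = k - x := by omega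
        have h2 : (0 : ℤ) ≤ (k : ℤ) - x := by omega
        simp [hx, hxk, h1]
      · have h2 : ¬ (x : ℤ) ≤ k := by omega
        simp [hxk, h2]
    have h0 : W {1, b, c} one (k : ℤ) = subW {1, b, c} one k := by simp [W]
    rw [h0, subW_eq]
    simp only [Set.mem_insert_iff, Set.mem_singleton_iff, exists_eq_or_imp, exists_eq_left,
      key 1 one_pos, key b hb, key c hc]
    push_cast
    split_ifs with h
    · simp only [false_iff]
      tauto
    · simp only [true_iff]
      tauto

/-- On `[s, s + len)` the set `Z` is `{s, s + 2, …, s + 2 (z - 1)}`. -/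
def Blk (Z : ℤ → Prop) (s len z : ℤ) : Prop :=
  ∀ t, 0 ≤ t → t < len → (Z (s + t) ↔ t % 2 = 0 ∧ t < 2 * z)

lemma Blk.mem {Z : ℤ → Prop} {s len z n : ℤ} (H : Blk Z s len z) (h1 : s ≤ n)
    (h2 : n < s + len) (h3 : (n - s) % 2 = 0) (h4 : n < s + 2 * z) : Z n := by
  have := (H (n - s) (by omega) (by omega)).2 ⟨h3, by omega⟩
  rwa [add_sub_cancel] at this

lemma Blk.notMem {Z : ℤ → Prop} {s len z n : ℤ} (H : Blk Z s len z) (h1 : s ≤ n)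
    (h2 : n < s + len) (h3 : (n - s) % 2 = 1 ∨ s + 2 * z ≤ n) : ¬ Z n := by
  intro hn
  have := (H (n - s) (by omega) (by omega)).1 (by rwa [add_sub_cancel])
  omega

lemma Blk.mem_iff {Z : ℤ → Prop} {s len z n : ℤ} (H : Blk Z s len z) (h1 : s ≤ n)
    (h2 : n < s + len) : Z n ↔ (n - s) % 2 = 0 ∧ n < s + 2 * z := by
  have := H (n - s) (by omega) (by omega)
  rw [add_sub_cancel] at this
  rw [this]
  omega

/-- A block may be verified one position at a time. -/
lemma Blk.of_step {b c : ℤ} {Z : ℤ → Prop} (hZ : IsZeroSet b c Z) {s len z : ℤ} (hs : 0 ≤ s)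
    (h0 : ¬ Z (s - 1))
    (hin : ∀ t, 0 ≤ t → t < len → t % 2 = 0 → t < 2 * z → Blk Z s t z →
      ¬ Z (s + t - b) ∧ ¬ Z (s + t - c))
    (hout : ∀ t, 0 ≤ t → t < len → 2 * z ≤ t → Blk Z s t z →
      Z (s + t - 1) ∨ Z (s + t - b) ∨ Z (s + t - c)) :
    Blk Z s len z := by
  have key : ∀ k : ℕ, (k : ℤ) ≤ len → Blk Z s k z := by
    intro k
    induction k with
    | zero => intro _ t h1 h2; simp at h2; omega
    | succ k ih =>
      intro hk
      push_cast at hk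
      have hB := ih (by omega)
      intro t ht1 ht2
      push_cast at ht2
      rcases (show t < k ∨ t = k by omega) with h | rfl
      · exact hB t ht1 h
      rw [hZ.iff _ (by omega)]
      by_cases hz : (k : ℤ) < 2 * z
      · by_cases hpar : (k : ℤ) % 2 = 0
        · have h1 := hin k ht1 (by omega) hpar hz hB
          refine iff_of_true ⟨?_, h1⟩ ⟨hpar, hz⟩
          rcases (show (k : ℤ) = 0 ∨ 1 ≤ (k : ℤ) by omega) with hk0 | hk0
          · rwa [hk0, add_zero]
          · exact hB.notMem (by omega) (by omega) (by omega)
        · refine iff_of_false ?_ (by omega)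
          have := hB.mem (n := s + k - 1) (by omega) (by omega) (by omega) (by omega)
          tauto
      · refine iff_of_false ?_ (by omega)
        have := hout k ht1 (by omega) (by omega) hB
        tauto
  intro t h1 h2
  exact key len.toNat (by omega) t h1 (by omega)

/-- Propagation of the period `b + c`. -/
lemma IsZeroSet.periodic_add {b c : ℤ} {Z : ℤ → Prop} (hZ : IsZeroSet b c Z) (hb : 0 < b)
    (hc : 0 < c) {N S : ℤ} (hN : N < S) (hS : 0 ≤ S)
    (base : ∀ n, N ≤ n → n < S → (Z n ↔ Z (n + (b + c))))
    (hQ : ∀ n, S ≤ n → n < S + (b + c) → (∀ k, N ≤ k → k < n → (Z k ↔ Z (k + (b + c)))) →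
      ¬ Z (n - 1) → ¬ Z n → Z (n + b) ∨ Z (n + c)) :
    ∀ n, N ≤ n → (Z n ↔ Z (n + (b + c))) := by
  have key : ∀ k : ℕ, ∀ n, N ≤ n → n < S + k → ((Z n ↔ Z (n + (b + c))) ∧
      (S ≤ n → ¬ Z (n - 1) → ¬ Z n → Z (n + b) ∨ Z (n + c))) := by
    intro k
    induction k with
    | zero => intro n h1 h2; exact ⟨base n h1 (by simpa using h2), by simp at h2; omega⟩
    | succ k ih =>
      intro n h1 h2
      push_cast at h2
      rcases (show n < S + k ∨ n = S + k by omega) with h | h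
      · exact ih n h1 h
      have hE : ∀ k, N ≤ k → k < n → (Z k ↔ Z (k + (b + c))) :=
        fun k hk hk' => (ih k hk (by omega)).1
      have hQn : ¬ Z (n - 1) → ¬ Z n → Z (n + b) ∨ Z (n + c) := by
        by_cases hn : n < S + (b + c)
        · exact hQ n (by omega) hn hE
        · have e1 := hE (n - (b + c) - 1) (by omega) (by omega)
          have e2 := hE (n - (b + c)) (by omega) (by omega)
          have e3 := hE (n - c) (by omega) (by omega)
          have e4 := hE (n - b) (by omega) (by omega)
          have e5 := (ih (n - (b + c)) (by omega) (by omega)).2 (by omega)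
          ring_nf at e1 e2 e3 e4 e5 ⊢
          tauto
      refine ⟨?_, fun _ => hQn⟩
      have e1 := hE (n - 1) (by omega) (by omega)
      have r0 := hZ.iff n (by omega)
      have r1 := hZ.iff (n + (b + c)) (by omega)
      have r2 : Z n → ¬ Z (n + b) := fun h h' =>
        ((hZ.iff (n + b) (by omega)).1 h').2.1 (by rwa [add_sub_cancel_right])
      have r3 : Z n → ¬ Z (n + c) := fun h h' =>
        ((hZ.iff (n + c) (by omega)).1 h').2.2 (by rwa [add_sub_cancel_right])
      rw [show n + (b + c) - 1 = n - 1 + (b + c) by ring, show n + (b + c) - b = n + c by ring,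
        show n + (b + c) - c = n + b by ring, ← e1] at r1
      clear hE e1 ih
      constructor
      · intro h
        exact r1.2 ⟨(r0.1 h).1, r3 h, r2 h⟩
      · intro h
        by_contra h'
        have := r1.1 h
        have := hQn this.1 h'
        tauto
  intro n hn
  exact (key (n - S + 1).toNat n hn (by omega)).1

/-- Propagation of the period `c + 1`. -/
lemma IsZeroSet.periodic_succ {b c : ℤ} {Z : ℤ → Prop} (hZ : IsZeroSet b c Z) (hb : 0 < b)
    (hc : 0 < c) {N S : ℤ} (hN : N + b + 1 = S) (hS : 0 ≤ S)
    (base : ∀ n, N ≤ n → n < S → (Z n ↔ Z (n + (c + 1))))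
    (hQ : ∀ n, S ≤ n → n < S + (c + 1) → (∀ k, N ≤ k → k < n → (Z k ↔ Z (k + (c + 1)))) →
      ¬ Z (n - 1) → ¬ Z n → ¬ Z (n - b) → Z (n + 1)) :
    ∀ n, N ≤ n → (Z n ↔ Z (n + (c + 1))) := by
  have key : ∀ k : ℕ, ∀ n, N ≤ n → n < S + k → ((Z n ↔ Z (n + (c + 1))) ∧
      (S ≤ n → ¬ Z (n - 1) → ¬ Z n → ¬ Z (n - b) → Z (n + 1))) := by
    intro k
    induction k with
    | zero => intro n h1 h2; exact ⟨base n h1 (by simpa using h2), by simp at h2; omega⟩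
    | succ k ih =>
      intro n h1 h2
      push_cast at h2
      rcases (show n < S + k ∨ n = S + k by omega) with h | h
      · exact ih n h1 h
      have hE : ∀ k, N ≤ k → k < n → (Z k ↔ Z (k + (c + 1))) :=
        fun k hk hk' => (ih k hk (by omega)).1
      have hQn : ¬ Z (n - 1) → ¬ Z n → ¬ Z (n - b) → Z (n + 1) := by
        by_cases hn : n < S + (c + 1)
        · exact hQ n (by omega) hn hE
        · have e1 := hE (n - (c + 1) - 1) (by omega) (by omega)
          have e2 := hE (n - (c + 1)) (by omega) (by omega)
          have e3 := hE (n - c) (by omega) (by omega)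
          have e4 := hE (n - (c + 1) - b) (by omega) (by omega)
          have e5 := (ih (n - (c + 1)) (by omega) (by omega)).2 (by omega)
          ring_nf at e1 e2 e3 e4 e5 ⊢
          tauto
      refine ⟨?_, fun _ => hQn⟩
      have e1 := hE (n - 1) (by omega) (by omega)
      have e2 := hE (n - b) (by omega) (by omega)
      have r0 := hZ.iff n (by omega)
      have r1 := hZ.iff (n + (c + 1)) (by omega)
      have r2 : Z n → ¬ Z (n + 1) := fun h h' =>
        ((hZ.iff (n + 1) (by omega)).1 h').1 (by rwa [add_sub_cancel_right])
      rw [show n + (c + 1) - 1 = n - 1 + (c + 1) by ring,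
        show n + (c + 1) - b = n - b + (c + 1) by ring,
        show n + (c + 1) - c = n + 1 by ring, ← e1, ← e2] at r1
      clear hE e1 e2 ih
      constructor
      · intro h
        exact r1.2 ⟨(r0.1 h).1, (r0.1 h).2.1, r2 h⟩
      · intro h
        by_contra h'
        have h1 := r1.1 h
        exact h1.2.2 (hQn h1.1 h' h1.2.1)
  intro n hn
  exact (key (n - S + 1).toNat n hn (by omega)).1

/-- Propagation of an arbitrary period from a window of length `c`. -/
lemma IsZeroSet.periodic_window {b c : ℤ} {Z : ℤ → Prop} (hZ : IsZeroSet b c Z) (hb : 0 < b)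
    (hbc : b ≤ c) {N p : ℤ} (hN : 0 ≤ N + c) (hp : 0 ≤ p)
    (base : ∀ n, N ≤ n → n < N + c → (Z n ↔ Z (n + p))) :
    ∀ n, N ≤ n → (Z n ↔ Z (n + p)) := by
  have key : ∀ k : ℕ, ∀ n, N ≤ n → n < N + c + k → (Z n ↔ Z (n + p)) := by
    intro k
    induction k with
    | zero => intro n h1 h2; exact base n h1 (by simpa using h2)
    | succ k ih =>
      intro n h1 h2
      push_cast at h2
      rcases (show n < N + c + k ∨ n = N + c + k by omega) with h | h
      · exact ih n h1 h
      have e1 := ih (n - 1) (by omega) (by omega)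
      have e2 := ih (n - b) (by omega) (by omega)
      have e3 := ih (n - c) (by omega) (by omega)
      rw [hZ.iff n (by omega), hZ.iff (n + p) (by omega), e1, e2, e3,
        show n + p - 1 = n - 1 + p by ring, show n + p - b = n - b + p by ring,
        show n + p - c = n - c + p by ring]
  intro n hn
  exact key (n - N - c + 1).toNat n hn (by omega)

section PurelyPeriodic

variable {b c : ℤ} {Z : ℤ → Prop}

lemma IsZeroSet.pure_of_odd_odd (hZ : IsZeroSet b c Z) (hb : b % 2 = 1) (hc : c % 2 = 1)
    (hb0 : 0 < b) (hc0 : 0 < c) : ∀ n, 0 ≤ n → (Z n ↔ Z (n + 2)) := by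
  have hB : ∀ z, Blk Z 0 (2 * z) z := fun z =>
    Blk.of_step hZ le_rfl (hZ.neg _ (by omega))
      (fun t h1 h2 h3 h4 hB => by
        have aux : ∀ x, 0 < x → x % 2 = 1 → ¬ Z (0 + t - x) := fun x hx hx' => by
          rcases lt_or_ge t x with h | h
          · exact hZ.neg _ (by omega)
          · exact hB.notMem (by omega) (by omega) (by omega)
        exact ⟨aux b hb0 hb, aux c hc0 hc⟩)
      (fun t h1 h2 h3 _ => by omega)
  intro n hn
  rw [(hB (n + 2)).mem_iff hn (by omega), (hB (n + 3)).mem_iff (by omega) (by omega)]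
  omega

lemma IsZeroSet.pure_of_odd_even (hZ : IsZeroSet b c Z) (hb : b % 2 = 1) (hc : c % 2 = 0)
    (hb0 : 0 < b) (hbc : b < c) : ∀ n, 0 ≤ n → (Z n ↔ Z (n + (b + c))) := by
  have hB : Blk Z 0 (b + c) (c / 2) := by
    refine Blk.of_step hZ le_rfl (hZ.neg _ (by omega)) (fun t h1 h2 h3 h4 hB => ⟨?_, ?_⟩)
      (fun t h1 h2 h3 hB => ?_)
    · rcases lt_or_ge t b with h | h
      · exact hZ.neg _ (by omega)
      · exact hB.notMem (by omega) (by omega) (by omega)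
    · exact hZ.neg _ (by omega)
    · right
      rcases Int.emod_two_eq_zero_or_one t with h | h
      · exact Or.inr (hB.mem (by omega) (by omega) (by omega) (by omega))
      · exact Or.inl (hB.mem (by omega) (by omega) (by omega) (by omega))
  have h0 : ∀ n, -1 ≤ n → n < 0 → (Z n ↔ Z (n + (b + c))) := fun n h1 h2 =>
    iff_of_false (hZ.neg _ h2) (hB.notMem (by omega) (by omega) (by omega))
  intro n hn
  refine hZ.periodic_add hb0 (by omega) (N := -1) (S := 0) (by omega) le_rfl h0 ?_ n (by omega)
  intro n h1 h2 hE hn1 hn2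
  have hnc : c ≤ n := by
    by_contra! h
    rcases Int.emod_two_eq_zero_or_one n with h' | h'
    · exact hn2 (hB.mem (by omega) (by omega) (by omega) (by omega))
    · exact hn1 (hB.mem (by omega) (by omega) (by omega) (by omega))
  rcases Int.emod_two_eq_zero_or_one n with h | h
  · left
    have := (hE (n - c) (by omega) (by omega)).1
      (hB.mem (by omega) (by omega) (by omega) (by omega))
    rwa [show n - c + (b + c) = n + b by ring] at this
  · right
    have := (hE (n - b) (by omega) (by omega)).1
      (hB.mem (by omega) (by omega) (by omega) (by omega))
    rwa [show n - b + (b + c) = n + c by ring] at this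

lemma pure_of_forall_blk {len z : ℤ} (hlen : 0 < len) (hB : ∀ k : ℕ, Blk Z (k * len) len z) :
    ∀ n, 0 ≤ n → (Z n ↔ Z (n + len)) := by
  intro n hn
  have h1 := Int.emod_add_mul_ediv n len
  have h2 := Int.emod_nonneg n hlen.ne'
  have h3 := Int.emod_lt_of_pos n hlen
  obtain ⟨k, hk⟩ := Int.eq_ofNat_of_zero_le (Int.ediv_nonneg hn hlen.le)
  have e1 := hB k _ h2 h3
  have e2 := hB (k + 1) _ h2 h3
  rw [show (k : ℤ) * len + n % len = n by linear_combination h1 - len * hk] at e1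
  rw [show ((k + 1 : ℕ) : ℤ) * len + n % len = n + len by
    push_cast; linear_combination h1 - len * hk] at e2
  rw [e1, e2]

lemma IsZeroSet.pure_of_eq_succ {h : ℤ} (hZ : IsZeroSet (2 * h) (2 * h + 1) Z) (hh : 0 < h) :
    ∀ n, 0 ≤ n → (Z n ↔ Z (n + 4 * h)) := by
  have step : ∀ s, 0 ≤ s →
      (∀ t, 0 ≤ t → t < 4 * h → (t % 2 = 1 ∨ 2 * h ≤ t) → ¬ Z (s - 4 * h + t)) →
      Blk Z s (4 * h) h := by
    intro s hs hprev
    refine Blk.of_step hZ hs ?_ (fun t h1 h2 h3 h4 hB => ⟨?_, ?_⟩) (fun t h1 h2 h3 hB => ?_)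
    · convert hprev (4 * h - 1) (by omega) (by omega) (by omega) using 2; ring
    · convert hprev (2 * h + t) (by omega) (by omega) (by omega) using 2; ring
    · convert hprev (2 * h - 1 + t) (by omega) (by omega) (by omega) using 2; ring
    · right
      rcases Int.emod_two_eq_zero_or_one t with h | h
      · exact Or.inl (hB.mem (by omega) (by omega) (by omega) (by omega))
      · exact Or.inr (hB.mem (by omega) (by omega) (by omega) (by omega))
  refine pure_of_forall_blk (z := h) (by omega) fun k => ?_
  induction k with
  | zero => exact step _ (by simp) fun t h1 h2 _ => hZ.neg _ (by simp; omega)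
  | succ k ih =>
    refine step _ (by positivity) fun t h1 h2 h3 => ?_
    push_cast
    rw [add_one_mul]
    exact ih.notMem (by omega) (by omega) (by omega)

lemma IsZeroSet.pure_of_add_one_eq_mul {h : ℤ} (hZ : IsZeroSet (2 * h) c Z) (hh : 0 < h) {m : ℕ}
    (hm : 1 ≤ m) (hc : c = m * (2 * h + 1) - 1) : ∀ n, 0 ≤ n → (Z n ↔ Z (n + (2 * h + 1))) := by
  refine pure_of_forall_blk (z := h) (by omega) fun k => ?_
  induction k using Nat.strong_induction_on with
  | _ k ih =>
  have hprev : ∀ i : ℕ, 1 ≤ i → ∀ t, 0 ≤ t → t ≤ 2 * h → (t % 2 = 1 ∨ 2 * h ≤ t) →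
      ¬ Z (k * (2 * h + 1) - i * (2 * h + 1) + t) := by
    intro i hi t h1 h2 h3
    rcases lt_or_ge k i with hki | hki
    · refine hZ.neg _ ?_
      have : ((k : ℤ) + 1) * (2 * h + 1) ≤ i * (2 * h + 1) :=
        mul_le_mul_of_nonneg_right (by exact_mod_cast hki) (by omega)
      rw [add_one_mul] at this
      omega
    · have := ih (k - i) (by omega)
      push_cast [hki] at this
      rw [sub_mul] at this
      exact this.notMem (by omega) (by omega) (by omega)
  refine Blk.of_step hZ (by positivity) ?_ (fun t h1 h2 h3 h4 hB => ⟨?_, ?_⟩)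
    (fun t h1 h2 h3 hB => ?_)
  · convert hprev 1 le_rfl (2 * h) (by omega) (by omega) (by omega) using 2; push_cast; ring
  · convert hprev 1 le_rfl (t + 1) (by omega) (by omega) (by omega) using 2; push_cast; ring
  · convert hprev m hm (t + 1) (by omega) (by omega) (by omega) using 2; rw [hc]; ring
  · exact Or.inr (Or.inl (hB.mem (by omega) (by omega) (by omega) (by omega)))

lemma exists_block_of_lt {len n : ℤ} {q : ℕ} (hlen : 0 < len) (hn : 0 ≤ n) (hq : n < q * len) :
    ∃ u : ℕ, u < q ∧ u * len ≤ n ∧ n < u * len + len := by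
  have h1 := Int.emod_add_mul_ediv n len
  have h2 := Int.emod_nonneg n hlen.ne'
  have h3 := Int.emod_lt_of_pos n hlen
  obtain ⟨k, hk⟩ := Int.eq_ofNat_of_zero_le (Int.ediv_nonneg hn hlen.le)
  rw [hk, mul_comm] at h1
  refine ⟨k, ?_, by omega, by omega⟩
  by_contra! h
  have : (q : ℤ) * len ≤ k * len := mul_le_mul_of_nonneg_right (by exact_mod_cast h) hlen.le
  omega

lemma IsZeroSet.blk_initial {h : ℤ} (hZ : IsZeroSet (2 * h) c Z) (hh : 0 < h) {q : ℕ}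
    (hc : q * (2 * h + 1) ≤ c) : ∀ u : ℕ, u < q → Blk Z (u * (2 * h + 1)) (2 * h + 1) h := by
  have step : ∀ s, 0 ≤ s → s + (2 * h + 1) ≤ c →
      (∀ t, 0 ≤ t → t ≤ 2 * h → (t % 2 = 1 ∨ 2 * h ≤ t) → ¬ Z (s - (2 * h + 1) + t)) →
      Blk Z s (2 * h + 1) h := by
    intro s hs hsc hprev
    refine Blk.of_step hZ hs ?_ (fun t h1 h2 h3 h4 hB => ⟨?_, ?_⟩) (fun t h1 h2 h3 hB => ?_)
    · convert hprev (2 * h) (by omega) (by omega) (by omega) using 2; ring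
    · convert hprev (t + 1) (by omega) (by omega) (by omega) using 2; ring
    · exact hZ.neg _ (by omega)
    · exact Or.inr (Or.inl (hB.mem (by omega) (by omega) (by omega) (by omega)))
  intro u
  induction u with
  | zero =>
    intro hu
    have : 1 * (2 * h + 1) ≤ q * (2 * h + 1) :=
      mul_le_mul_of_nonneg_right (by exact_mod_cast hu) (by omega)
    exact step _ (by simp) (by simp; omega) fun t h1 h2 _ => hZ.neg _ (by simp; omega)
  | succ u ih =>
    intro hu
    have hB := ih (by omega)
    have : ((u : ℤ) + 1 + 1) * (2 * h + 1) ≤ q * (2 * h + 1) :=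
      mul_le_mul_of_nonneg_right (by exact_mod_cast hu) (by omega)
    rw [add_one_mul, add_one_mul] at this
    refine step _ (by positivity) ?_ fun t h1 h2 h3 => ?_
    · push_cast
      rw [add_one_mul]
      omega
    · push_cast
      rw [add_one_mul]
      exact hB.notMem (by omega) (by omega) (by omega)

/-- The block following the initial blocks when the remainder is even. -/
lemma IsZeroSet.blk_even_remainder {h ρ : ℤ} (hZ : IsZeroSet (2 * h) c Z) (hh : 0 < h) {q : ℕ}
    (hq : 1 ≤ q) (hρ : 0 ≤ ρ) (hρh : ρ < h) (hc : c = q * (2 * h + 1) + 2 * ρ) :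
    Blk Z (q * (2 * h + 1)) (2 * h - 1) ρ := by
  obtain ⟨q, rfl⟩ := Nat.exists_eq_add_of_le' hq
  have hI := hZ.blk_initial hh (q := q + 1) (by omega)
  have h0 := hI 0 (by omega)
  have hprev := hI q (by omega)
  push_cast at hc h0 ⊢
  rw [add_one_mul] at hc ⊢
  have : 0 ≤ (q : ℤ) * (2 * h + 1) := by positivity
  refine Blk.of_step hZ (by omega) (hprev.notMem (by omega) (by omega) (by omega))
    (fun t h1 h2 h3 h4 hB => ⟨hprev.notMem (by omega) (by omega) (by omega), hZ.neg _ (by omega)⟩)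
    (fun t h1 h2 h3 hB => Or.inr ?_)
  rcases Int.emod_two_eq_zero_or_one t with h | h
  · exact Or.inr (h0.mem (by omega) (by omega) (by omega) (by omega))
  · exact Or.inl (hprev.mem (by omega) (by omega) (by omega) (by omega))

lemma IsZeroSet.pure_of_remainder_eq {h : ℤ} (hZ : IsZeroSet (2 * h) c Z) (hh : 0 < h) {q : ℕ}
    (hq : 1 ≤ q) (hc : c = q * (2 * h + 1) + (2 * h - 2)) :
    ∀ n, 0 ≤ n → (Z n ↔ Z (n + (c + 1))) := by
  have hI := hZ.blk_initial hh (q := q) (by omega)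
  have hL := hZ.blk_even_remainder hh hq (ρ := h - 1) (by omega) (by omega) (by rw [hc]; ring)
  have h0 := hI 0 (by omega)
  push_cast at h0
  have hqpos : 1 * (2 * h + 1) ≤ q * (2 * h + 1) :=
    mul_le_mul_of_nonneg_right (by exact_mod_cast hq) (by omega)
  have hN : Blk Z (c + 1) (2 * h + 1) h := by
    refine Blk.of_step hZ (by omega) (hL.notMem (by omega) (by omega) (by omega))
      (fun t h1 h2 h3 h4 hB => ⟨?_, h0.notMem (by omega) (by omega) (by omega)⟩)
      (fun t h1 h2 h3 hB => Or.inr (Or.inl (hB.mem (by omega) (by omega) (by omega) (by omega))))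
    rcases (show t = 0 ∨ 2 ≤ t by omega) with h' | h'
    · obtain ⟨q, rfl⟩ := Nat.exists_eq_add_of_le' hq
      have hp := hI q (by omega)
      push_cast at hc
      rw [add_one_mul] at hc
      exact hp.notMem (by omega) (by omega) (by omega)
    · exact hL.notMem (by omega) (by omega) (by omega)
  refine hZ.periodic_succ (N := 0) (S := 2 * h + 1) (by omega) (by omega) (by omega) (by omega)
    (fun n h1 h2 => ?_) (fun n h1 h2 hE hn1 hn2 hn3 => ?_)
  · rw [h0.mem_iff (by omega) (by omega), hN.mem_iff (by omega) (by omega)]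
    omega
  · rcases lt_or_ge n (q * (2 * h + 1)) with hlt | hge
    · obtain ⟨u, hu, hu1, hu2⟩ := exists_block_of_lt (by omega) (by omega) hlt
      have hBu := hI u hu
      rw [hBu.mem_iff hu1 hu2] at hn2
      rcases (show n = u * (2 * h + 1) + 2 * h ∨ (n - u * (2 * h + 1)) % 2 = 1 by omega) with h' | h'
      · exact absurd (hBu.mem (by omega) (by omega) (by omega) (by omega)) hn3
      · exact absurd (hBu.mem (by omega) (by omega) (by omega) (by omega)) hn1
    · rcases lt_or_ge n (c + 1) with hlt' | hge'
      · rw [hL.mem_iff (by omega) (by omega)] at hn2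
        rcases (show n = c ∨ (n - q * (2 * h + 1)) % 2 = 1 by omega) with h' | h'
        · exact hN.mem (by omega) (by omega) (by omega) (by omega)
        · exact absurd (hL.mem (by omega) (by omega) (by omega) (by omega)) hn1
      · rw [hN.mem_iff (by omega) (by omega)] at hn2
        rcases (show n = c + 1 + 2 * h ∨ (n - (c + 1)) % 2 = 1 by omega) with h' | h'
        · exact absurd (hN.mem (by omega) (by omega) (by omega) (by omega)) hn3
        · exact absurd (hN.mem (by omega) (by omega) (by omega) (by omega)) hn1

lemma IsZeroSet.pure_of_odd_remainder {h r : ℤ} (hZ : IsZeroSet (2 * h) c Z) (hh : 0 < h) {q : ℕ}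
    (hq : 1 ≤ q) (hr : 0 ≤ r) (hr2 : r % 2 = 1) (hrh : r < 2 * h)
    (hc : c = q * (2 * h + 1) + r) : ∀ n, 0 ≤ n → (Z n ↔ Z (n + (2 * h + c))) := by
  have hI := hZ.blk_initial hh (q := q) (by omega)
  have h0 := hI 0 (by omega)
  push_cast at h0
  have hqpos : 1 * (2 * h + 1) ≤ q * (2 * h + 1) :=
    mul_le_mul_of_nonneg_right (by exact_mod_cast hq) (by omega)
  have hL : Blk Z (q * (2 * h + 1)) (2 * h + r) h := by
    obtain ⟨q, rfl⟩ := Nat.exists_eq_add_of_le' hq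
    have hp := hI q (by omega)
    push_cast at hc hqpos ⊢
    rw [add_one_mul] at hc hqpos ⊢
    refine Blk.of_step hZ (by omega) (hp.notMem (by omega) (by omega) (by omega))
      (fun t h1 h2 h3 h4 hB => ⟨hp.notMem (by omega) (by omega) (by omega), ?_⟩)
      (fun t h1 h2 h3 hB => Or.inr ?_)
    · rcases lt_or_ge t r with h' | h'
      · exact hZ.neg _ (by omega)
      · exact h0.notMem (by omega) (by omega) (by omega)
    · rcases Int.emod_two_eq_zero_or_one t with h' | h'
      · exact Or.inl (hB.mem (by omega) (by omega) (by omega) (by omega))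
      · exact Or.inr (h0.mem (by omega) (by omega) (by omega) (by omega))
  intro n hn
  refine hZ.periodic_add (N := -1) (S := 0) (by omega) (by omega) (by omega) le_rfl ?_ ?_ n
    (by omega)
  · exact fun n h1 h2 => iff_of_false (hZ.neg _ h2) (hL.notMem (by omega) (by omega) (by omega))
  · intro n h1 h2 hE hn1 hn2
    rcases lt_or_ge n (q * (2 * h + 1)) with hlt | hge
    · obtain ⟨u, hu, hu1, hu2⟩ := exists_block_of_lt (by omega) (by omega) hlt
      have hBu := hI u hu
      rw [hBu.mem_iff hu1 hu2] at hn2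
      rcases (show n = u * (2 * h + 1) + 2 * h ∨ (n - u * (2 * h + 1)) % 2 = 1 by omega) with h' | h'
      · right
        have : 0 ≤ (u : ℤ) * (2 * h + 1) := by positivity
        have := (hE (n - 2 * h) (by omega) (by omega)).1
          (hBu.mem (by omega) (by omega) (by omega) (by omega))
        rwa [show n - 2 * h + (2 * h + c) = n + c by ring] at this
      · exact absurd (hBu.mem (by omega) (by omega) (by omega) (by omega)) hn1
    · have hn3 : q * (2 * h + 1) + 2 * h ≤ n := by
        by_contra! hlt
        rcases Int.emod_two_eq_zero_or_one (n - q * (2 * h + 1)) with h' | h'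
        · exact hn2 (hL.mem (by omega) (by omega) (by omega) (by omega))
        · exact hn1 (hL.mem (by omega) (by omega) (by omega) (by omega))
      rcases Int.emod_two_eq_zero_or_one (n - q * (2 * h + 1)) with h' | h'
      · right
        have := (hE (n - 2 * h) (by omega) (by omega)).1
          (hL.mem (by omega) (by omega) (by omega) (by omega))
        rwa [show n - 2 * h + (2 * h + c) = n + c by ring] at this
      · left
        have := (hE (n - c) (by omega) (by omega)).1
          (h0.mem (by omega) (by omega) (by omega) (by omega))
        rwa [show n - c + (2 * h + c) = n + 2 * h by ring] at this

end PurelyPeriodic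

section Rows

variable {c h : ℤ} {Z : ℤ → Prop}

/-- A row consists of `a` long blocks, then `e` short blocks, then a block with `m` zeros. -/
structure Row (Z : ℤ → Prop) (h S : ℤ) (a e : ℕ) (m : ℤ) : Prop where
  long : ∀ u : ℕ, u < a → Blk Z (S + u * (2 * h + 1)) (2 * h + 1) h
  short : ∀ i : ℕ, i < e → Blk Z (S + a * (2 * h + 1) + i * (2 * h - 1)) (2 * h - 1) (h - 1)
  gap : Blk Z (S + a * (2 * h + 1) + e * (2 * h - 1)) (2 * h - 1) m

lemma IsZeroSet.blk_long (hZ : IsZeroSet (2 * h) c Z) (hh : 0 < h) {s : ℤ} (hs : 0 ≤ s)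
    (h0 : ¬ Z (s - 1)) (hb : ∀ t, 0 ≤ t → t < 2 * h → t % 2 = 0 → ¬ Z (s + t - 2 * h))
    (hc : ∀ t, 0 ≤ t → t < 2 * h → t % 2 = 0 → ¬ Z (s + t - c)) : Blk Z s (2 * h + 1) h :=
  Blk.of_step hZ hs h0 (fun t h1 _ h3 h4 _ => ⟨hb t h1 h4 h3, hc t h1 h4 h3⟩)
    (fun _ _ _ _ hB => Or.inr (Or.inl (hB.mem (by omega) (by omega) (by omega) (by omega))))

lemma IsZeroSet.blk_short (hZ : IsZeroSet (2 * h) c Z) {s : ℤ} (hs : 0 ≤ s)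
    (h0 : ¬ Z (s - 1)) (hb : ∀ t, 0 ≤ t → t < 2 * h - 2 → t % 2 = 0 → ¬ Z (s + t - 2 * h))
    (hc : ∀ t, 0 ≤ t → t < 2 * h - 2 → t % 2 = 0 → ¬ Z (s + t - c))
    (hz : Z (s + (2 * h - 2) - c)) : Blk Z s (2 * h - 1) (h - 1) :=
  Blk.of_step hZ hs h0
    (fun t h1 _ h3 h4 _ => ⟨hb t h1 (by omega) h3, hc t h1 (by omega) h3⟩)
    (fun t _ _ _ _ => by obtain rfl : t = 2 * h - 2 := by omega
                         exact Or.inr (Or.inr hz))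

namespace Row

variable {S m : ℤ} {a e : ℕ}

lemma first_notMem (R : Row Z h S (a + 1) e m) {t : ℤ} (h0 : 0 ≤ t) (ht : t ≤ 2 * h)
    (h2 : t % 2 = 1) : ¬ Z (S + t) := by
  have := R.long 0 (by omega)
  push_cast at this
  exact this.notMem (by omega) (by omega) (by omega)

/-- The block following the long blocks of a row. -/
lemma after_long (R : Row Z h S a e m) (hh : 2 ≤ h) (hm : 0 ≤ m) (hm2 : m < h) (hem : 1 ≤ e + m) :
    Z (S + a * (2 * h + 1)) := by
  rcases Nat.eq_zero_or_pos e with rfl | he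
  · have := R.gap
    push_cast at this hem
    exact this.mem (by omega) (by omega) (by omega) (by omega)
  · have := R.short 0 he
    push_cast at this
    exact this.mem (by omega) (by omega) (by omega) (by omega)

lemma second_mem (R : Row Z h S (a + 1) e m) (hh : 2 ≤ h) (hm : 0 ≤ m) (hm2 : m < h)
    (hne : 2 ≤ a + 1 + e + m) : Z (S + (2 * h + 1)) := by
  rcases Nat.eq_zero_or_pos a with rfl | ha
  · have := R.after_long hh hm hm2 (by omega)
    push_cast at this
    simpa using this
  · have := R.long 1 (by omega)
    push_cast at this
    exact this.mem (by omega) (by omega) (by omega) (by omega)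

/-- The position before the final block of a nonempty row is not a zero. -/
lemma before_gap (R : Row Z h S a e m) (hh : 2 ≤ h) (hae : 1 ≤ a + e) :
    ¬ Z (S + a * (2 * h + 1) + e * (2 * h - 1) - 1) := by
  rcases Nat.eq_zero_or_pos e with rfl | he
  · obtain ⟨a, rfl⟩ := Nat.exists_eq_add_of_le' (show 1 ≤ a by omega)
    have := R.long a (by omega)
    push_cast
    rw [add_one_mul]
    exact this.notMem (by omega) (by omega) (by omega)
  · obtain ⟨e, rfl⟩ := Nat.exists_eq_add_of_le' he
    have := R.short e (by omega)
    push_cast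
    rw [add_one_mul (e : ℤ)]
    exact this.notMem (by omega) (by omega) (by omega)

/-- The block between two rows. -/
lemma tail (hZ : IsZeroSet (2 * h) c Z) (R : Row Z h S (a + 1) e m) (hS : 0 ≤ S) (hm : 0 ≤ m)
    (hmh : m + 2 ≤ h) (hne : 2 ≤ a + 1 + e + m)
    (hc : c = (a + 1 : ℕ) * (2 * h + 1) + e * (2 * h - 1) + 2 * m) :
    Blk Z (S + c - 2 * m + (2 * h - 1)) (2 * m + 3) (m + 1) := by
  have hG := R.gap
  have hG0 := R.before_gap (by omega) (by omega)
  have h2 := R.second_mem (by omega) hm (by omega) hne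
  rw [show S + (a + 1 : ℕ) * (2 * h + 1) + e * (2 * h - 1) = S + c - 2 * m by rw [hc]; ring]
    at hG hG0
  have hcpos : 0 ≤ c - 2 * m := by
    rw [hc, add_sub_cancel_right]
    exact add_nonneg (mul_nonneg (by positivity) (by omega)) (mul_nonneg (by positivity) (by omega))
  refine Blk.of_step hZ (by omega) (hG.notMem (by omega) (by omega) (by omega))
    (fun t h1 h2 h3 h4 hB => ⟨?_, ?_⟩) (fun t h3 h4 h5 hB => ?_)
  · rcases (show t = 0 ∨ 1 ≤ t by omega) with rfl | h'
    · convert hG0 using 2; ring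
    · exact hG.notMem (by omega) (by omega) (by omega)
  · convert R.first_notMem (t := 2 * h - 1 - 2 * m + t) (by omega) (by omega) (by omega) using 2
    ring
  · obtain rfl : t = 2 * m + 2 := by omega
    right; right
    convert h2 using 1
    ring

lemma next (hZ : IsZeroSet (2 * h) c Z) (R : Row Z h S (a + 1) e m) (hS : 0 ≤ S) (hem : e ≤ m)
    (hmh : m + 2 ≤ h) (hne : 2 ≤ a + 1 + e + m)
    (hc : c = (a + 1 : ℕ) * (2 * h + 1) + e * (2 * h - 1) + 2 * m) :
    Row Z h (S + (2 * h + c + 2)) a (e + 1) (m + 1) := by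
  have hX := R.tail hZ hS (by omega) hmh hne hc
  have hG := R.gap
  have hcpos : 0 ≤ c - 2 * m := by
    rw [hc, add_sub_cancel_right]
    exact add_nonneg (mul_nonneg (by positivity) (by omega)) (mul_nonneg (by positivity) (by omega))
  have hGc : S + (a + 1 : ℕ) * (2 * h + 1) + e * (2 * h - 1) = S + c - 2 * m := by rw [hc]; ring
  have hG' := hG
  rw [hGc] at hG'
  have hS1 : ¬ Z (S + (2 * h + c + 2) - 1) := hX.notMem (by omega) (by omega) (by omega)
  have hSb : ∀ t, 0 ≤ t → t < 2 * h → t % 2 = 0 → ¬ Z (S + (2 * h + c + 2) + t - 2 * h) := by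
    intro t h1 h2 h3
    rcases lt_or_ge (2 * m + 2 + t) (2 * h - 1) with h' | h'
    · exact hG'.notMem (by omega) (by omega) (by omega)
    · exact hX.notMem (by omega) (by omega) (by omega)
  have hL : ∀ u : ℕ, u < a → Blk Z (S + (2 * h + c + 2) + u * (2 * h + 1)) (2 * h + 1) h := by
    intro u
    induction u with
    | zero =>
      intro hu
      have hp := R.long 1 (by omega)
      push_cast at hp ⊢
      rw [zero_mul, add_zero]
      refine hZ.blk_long (by omega) (by omega) hS1 hSb fun t h1 h2 h3 => ?_
      exact hp.notMem (by omega) (by omega) (by omega)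
    | succ u ih =>
      intro hu
      have hp := R.long (u + 2) (by omega)
      have hq := ih (by omega)
      have : 0 ≤ (u : ℤ) * (2 * h + 1) := mul_nonneg (by positivity) (by omega)
      push_cast at hp ⊢
      rw [add_mul] at hp ⊢
      refine hZ.blk_long (by omega) (by omega) (hq.notMem (by omega) (by omega) (by omega))
        (fun t h1 h2 h3 => ?_) fun t h1 h2 h3 => ?_
      · exact hq.notMem (by omega) (by omega) (by omega)
      · exact hp.notMem (by omega) (by omega) (by omega)
  have hold : ∀ i : ℕ, i ≤ e →
      (∀ t, 0 ≤ t → t < 2 * h - 2 → t % 2 = 0 →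
        ¬ Z (S + (2 * h + c + 2) + a * (2 * h + 1) + i * (2 * h - 1) + t - c)) ∧
      Z (S + (2 * h + c + 2) + a * (2 * h + 1) + i * (2 * h - 1) + (2 * h - 2) - c) := by
    intro i hi
    push_cast at hc hG
    rw [add_one_mul] at hc hG
    rcases hi.lt_or_eq with hi | rfl
    · have hB := R.short i hi
      push_cast at hB
      rw [add_one_mul] at hB
      refine ⟨fun t h1 h2 h3 => hB.notMem (by omega) (by omega) (by omega), ?_⟩
      rcases (Nat.succ_le_of_lt hi).lt_or_eq with hi' | rfl
      · have hB' := R.short _ hi'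
        push_cast at hB'
        rw [add_one_mul, add_one_mul] at hB'
        exact hB'.mem (by omega) (by omega) (by omega) (by omega)
      · push_cast at hG hem
        rw [add_one_mul (i : ℤ)] at hG
        exact hG.mem (by omega) (by omega) (by omega) (by omega)
    · refine ⟨fun t h1 h2 h3 => hG.notMem (by omega) (by omega) (by omega), ?_⟩
      exact hX.mem (by omega) (by omega) (by omega) (by omega)
  have hSh : ∀ i : ℕ, i < e + 1 →
      Blk Z (S + (2 * h + c + 2) + a * (2 * h + 1) + i * (2 * h - 1)) (2 * h - 1) (h - 1) ∧
      ¬ Z (S + (2 * h + c + 2) + a * (2 * h + 1) + i * (2 * h - 1) - 1) := by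
    have hapos : 0 ≤ (a : ℤ) * (2 * h + 1) := mul_nonneg (by positivity) (by omega)
    intro i
    induction i with
    | zero =>
      intro _
      obtain ⟨o1, o2⟩ := hold 0 (by omega)
      push_cast at o1 o2 ⊢
      rw [zero_mul, add_zero] at o1 o2 ⊢
      rcases Nat.eq_zero_or_pos a with rfl | ha
      · push_cast at o1 o2 ⊢
        rw [zero_mul, add_zero] at o1 o2 ⊢
        exact ⟨hZ.blk_short (by omega) hS1 (fun t h1 h2 h3 => hSb t h1 (by omega) h3) o1 o2, hS1⟩
      · obtain ⟨a, rfl⟩ := Nat.exists_eq_add_of_le' ha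
        have hB := hL a (by omega)
        have h1 : ¬ Z (S + (2 * h + c + 2) + (a + 1 : ℕ) * (2 * h + 1) - 1) := by
          push_cast
          rw [add_one_mul]
          exact hB.notMem (by omega) (by omega) (by omega)
        refine ⟨hZ.blk_short (by omega) h1 (fun t h1 h2 h3 => ?_) o1 o2, h1⟩
        push_cast
        rw [add_one_mul]
        exact hB.notMem (by omega) (by omega) (by omega)
    | succ i ih =>
      intro hi
      obtain ⟨hB, hB0⟩ := ih (by omega)
      obtain ⟨o1, o2⟩ := hold (i + 1) (by omega)
      have : 0 ≤ (i : ℤ) * (2 * h - 1) := mul_nonneg (by positivity) (by omega)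
      push_cast at o1 o2 ⊢
      rw [add_one_mul] at o1 o2 ⊢
      have h1 : ¬ Z (S + (2 * h + c + 2) + a * (2 * h + 1) + (i * (2 * h - 1) + (2 * h - 1)) - 1) :=
        hB.notMem (by omega) (by omega) (by omega)
      refine ⟨hZ.blk_short (by omega) h1 (fun t h1 h2 h3 => ?_) o1 o2, h1⟩
      rcases (show t = 0 ∨ 1 ≤ t by omega) with rfl | h'
      · convert hB0 using 2; ring
      · exact hB.notMem (by omega) (by omega) (by omega)
  refine ⟨hL, fun i hi => (hSh i hi).1, ?_⟩
  obtain ⟨hB, hB0⟩ := hSh e (by omega)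
  have hfirst : ∀ t, 0 ≤ t → t < 2 * h - 2 → t % 2 = 0 → Z (S + (2 * h + c + 2) + t) := by
    intro t h1 h2 h3
    rcases Nat.eq_zero_or_pos a with rfl | ha
    · have := (hSh 0 (by omega)).1
      push_cast at this
      exact this.mem (by omega) (by omega) (by omega) (by omega)
    · have := hL 0 ha
      push_cast at this
      exact this.mem (by omega) (by omega) (by omega) (by omega)
  push_cast at hc ⊢
  rw [add_one_mul] at hc ⊢
  have : 0 ≤ (a : ℤ) * (2 * h + 1) := mul_nonneg (by positivity) (by omega)
  have : 0 ≤ (e : ℤ) * (2 * h - 1) := mul_nonneg (by positivity) (by omega)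
  refine Blk.of_step hZ (by omega) (hB.notMem (by omega) (by omega) (by omega))
    (fun t h1 h2 h3 h4 _ => ⟨?_, hX.notMem (by omega) (by omega) (by omega)⟩)
    (fun t h1 h2 h3 _ => Or.inr ?_)
  · rcases (show t = 0 ∨ 1 ≤ t by omega) with rfl | h'
    · convert hB0 using 2; ring
    · exact hB.notMem (by omega) (by omega) (by omega)
  · rcases Int.emod_two_eq_zero_or_one t with h' | h'
    · right
      convert hfirst (t - 2 * (m + 1)) (by omega) (by omega) (by omega) using 1
      omega
    · left
      exact hB.mem (by omega) (by omega) (by omega) (by omega)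

end Row

lemma IsZeroSet.row {ρ : ℤ} {q : ℕ} (hZ : IsZeroSet (2 * h) c Z) (hq : 1 ≤ q) (hρ : 0 ≤ ρ)
    (hne : 2 ≤ q + ρ) (hc : c = q * (2 * h + 1) + 2 * ρ) :
    ∀ j a : ℕ, a + j = q → ρ + j < h → Row Z h (j * (2 * h + c + 2)) a j (ρ + j) := by
  intro j
  induction j with
  | zero =>
    intro a ha hh
    obtain rfl : a = q := by omega
    push_cast at hh ⊢
    rw [zero_mul, add_zero]
    refine ⟨fun u hu => ?_, fun i hi => by omega, ?_⟩
    · rw [zero_add]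
      exact hZ.blk_initial (by omega) (by omega) u hu
    · have := hZ.blk_even_remainder (by omega) hq hρ (by omega) hc
      simpa using this
  | succ j ih =>
    intro a ha hh
    push_cast at hh
    have hcpos : 0 ≤ c := by
      rw [hc]
      exact add_nonneg (mul_nonneg (by positivity) (by omega)) (by omega)
    have := (ih (a + 1) (by omega) (by omega)).next hZ (mul_nonneg (by positivity) (by omega))
      (by omega) (by omega) (by omega) (by rw [hc, ← ha]; push_cast; ring)
    push_cast
    rwa [add_one_mul, ← add_assoc ρ]

end Rows

section EventualPeriod

variable {c h : ℤ} {Z : ℤ → Prop}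

/-- `P` is the least period of `Z` from `N` on, and `N` cannot be decreased. -/
structure HasPeriodFrom (Z : ℤ → Prop) (N P : ℤ) : Prop where
  periodic : ∀ n, N ≤ n → (Z n ↔ Z (n + P))
  pre : ¬ (Z (N - 1) ↔ Z (N - 1 + P))
  min : ∀ p, 0 < p → (∀ n, N ≤ n → (Z n ↔ Z (n + p))) → P ≤ p

/-- A pattern occurring once per `P` positions forces every period to be at least `P`. -/
lemma le_of_unique_pattern {φ : ℤ → Prop} {S P p x₀ : ℤ} (hp : 0 < p)
    (hφP : ∀ x, S ≤ x → (φ x ↔ φ (x + P))) (hφp : ∀ x, S ≤ x → (φ x ↔ φ (x + p)))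
    (h1 : S ≤ x₀) (h2 : x₀ < S + P) (hx₀ : φ x₀)
    (huniq : ∀ x, S ≤ x → x < S + P → φ x → x = x₀) : P ≤ p := by
  by_contra! hlt
  have h3 := (hφp x₀ h1).1 hx₀
  rcases lt_or_ge (x₀ + p) (S + P) with h4 | h4
  · have := huniq _ (by omega) h4 h3
    omega
  · have := huniq (x₀ + p - P) (by omega) (by omega)
      ((hφP _ (by omega)).2 (by rwa [sub_add_cancel]))
    omega

namespace Row

variable {S m : ℤ} {a e : ℕ}

lemma exists_long (R : Row Z h S a e m) (hh : 0 < h) {n : ℤ} (h1 : S ≤ n)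
    (h2 : n < S + a * (2 * h + 1)) :
    ∃ u : ℕ, u < a ∧ S + u * (2 * h + 1) ≤ n ∧ n < S + u * (2 * h + 1) + (2 * h + 1) ∧
      Blk Z (S + u * (2 * h + 1)) (2 * h + 1) h := by
  obtain ⟨u, hu, h3, h4⟩ := exists_block_of_lt (len := 2 * h + 1) (n := n - S) (q := a)
    (by omega) (by omega) (by omega)
  exact ⟨u, hu, by omega, by omega, R.long u hu⟩

lemma exists_short (R : Row Z h S a e m) (hh : 0 < h) {n : ℤ} (h1 : S + a * (2 * h + 1) ≤ n)
    (h2 : n < S + a * (2 * h + 1) + e * (2 * h - 1)) :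
    ∃ i : ℕ, i < e ∧ S + a * (2 * h + 1) + i * (2 * h - 1) ≤ n ∧
      n < S + a * (2 * h + 1) + i * (2 * h - 1) + (2 * h - 1) ∧
      Blk Z (S + a * (2 * h + 1) + i * (2 * h - 1)) (2 * h - 1) (h - 1) := by
  obtain ⟨i, hi, h3, h4⟩ := exists_block_of_lt (len := 2 * h - 1)
    (n := n - (S + a * (2 * h + 1))) (q := e) (by omega) (by omega) (by omega)
  exact ⟨i, hi, by omega, by omega, R.short i hi⟩

/-- If the last block of a row is short, it counts as one more short block. -/
lemma short_le (R : Row Z h S a e (h - 1)) {i : ℕ} (hi : i ≤ e) :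
    Blk Z (S + a * (2 * h + 1) + i * (2 * h - 1)) (2 * h - 1) (h - 1) := by
  rcases hi.lt_or_eq with hi | rfl
  · exact R.short i hi
  · exact R.gap

lemma hasPeriodFrom_succ (hZ : IsZeroSet (2 * h) c Z) (R : Row Z h S a e (h - 1)) (hh : 2 ≤ h)
    (ha : 1 ≤ a) (he : 1 ≤ e) (hS : 2 * h + 1 ≤ S)
    (hX : Blk Z (S - 2 * h + 1) (2 * h - 1) (h - 1))
    (hY : Blk Z (S - 4 * h + 2) (2 * h - 1) (h - 2))
    (hc : c = a * (2 * h + 1) + e * (2 * h - 1) + 2 * (h - 1)) :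
    HasPeriodFrom Z (S - 2 * h - 1) (c + 1) := by
  have hG := R.gap
  obtain ⟨e, rfl⟩ := Nat.exists_eq_add_of_le' he
  obtain ⟨a, rfl⟩ := Nat.exists_eq_add_of_le' ha
  have hlast := R.short e (by omega)
  have hapos : 0 ≤ (a : ℤ) * (2 * h + 1) := mul_nonneg (by positivity) (by omega)
  have hepos : 0 ≤ (e : ℤ) * (2 * h - 1) := mul_nonneg (by positivity) (by omega)
  have hcS : S + (a + 1 : ℕ) * (2 * h + 1) + (e + 1 : ℕ) * (2 * h - 1) = S + c - 2 * h + 2 := by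
    rw [hc]; ring
  have hcS' : S + (a + 1 : ℕ) * (2 * h + 1) + e * (2 * h - 1) = S + c - 4 * h + 3 := by
    rw [hc]; push_cast; ring
  rw [hcS] at hG
  rw [hcS'] at hlast
  have hA : ((a + 1 : ℕ) : ℤ) * (2 * h + 1) = a * (2 * h + 1) + (2 * h + 1) := by push_cast; ring
  have hE : ((e + 1 : ℕ) : ℤ) * (2 * h - 1) = e * (2 * h - 1) + (2 * h - 1) := by push_cast; ring
  have hS0 : Z S := by
    have := R.long 0 (by omega)
    push_cast at this
    exact this.mem (by omega) (by omega) (by omega) (by omega)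
  have hcover : ∀ n, S ≤ n → n < S + (c + 1) →
      (∃ u : ℕ, u < a + 1 ∧ S + u * (2 * h + 1) ≤ n ∧ n < S + u * (2 * h + 1) + (2 * h + 1) ∧
        Blk Z (S + u * (2 * h + 1)) (2 * h + 1) h) ∨
      (∃ i : ℕ, i ≤ e + 1 ∧ S + (a + 1 : ℕ) * (2 * h + 1) + i * (2 * h - 1) ≤ n ∧
        n < S + (a + 1 : ℕ) * (2 * h + 1) + i * (2 * h - 1) + (2 * h - 1) ∧
        Blk Z (S + (a + 1 : ℕ) * (2 * h + 1) + i * (2 * h - 1)) (2 * h - 1) (h - 1)) := by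
    intro n h1 h2
    rcases lt_or_ge n (S + (a + 1 : ℕ) * (2 * h + 1)) with h3 | h3
    · exact Or.inl (R.exists_long (by omega) h1 h3)
    · right
      rcases lt_or_ge n (S + (a + 1 : ℕ) * (2 * h + 1) + (e + 1 : ℕ) * (2 * h - 1)) with h4 | h4
      · obtain ⟨i, hi, h5⟩ := R.exists_short (by omega) h3 h4
        exact ⟨i, by omega, h5⟩
      · exact ⟨e + 1, le_rfl, h4, by omega, R.gap⟩
  have hper : ∀ n, S - 2 * h - 1 ≤ n → (Z n ↔ Z (n + (c + 1))) := by
    refine hZ.periodic_succ (S := S) (by omega) (by omega) (by omega) (by omega)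
      (fun n h1 h2 => ?_) (fun n h1 h2 hEn hn1 hn2 hn3 => ?_)
    · rcases lt_or_ge n (S - 2 * h + 1) with h3 | h3
      · exact iff_of_false (hY.notMem (by omega) (by omega) (by omega))
          (hlast.notMem (by omega) (by omega) (by omega))
      · rw [hX.mem_iff (by omega) (by omega), hG.mem_iff (by omega) (by omega)]
        omega
    · rcases hcover n h1 h2 with ⟨u, hu, h3, h4, hB⟩ | ⟨i, hi, h3, h4, hB⟩
      · rw [hB.mem_iff h3 h4] at hn2
        rcases (show n = S + u * (2 * h + 1) + 2 * h ∨ (n - (S + u * (2 * h + 1))) % 2 = 1 by omega)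
          with h' | h'
        · exact absurd (hB.mem (by omega) (by omega) (by omega) (by omega)) hn3
        · exact absurd (hB.mem (by omega) (by omega) (by omega) (by omega)) hn1
      · rw [hB.mem_iff h3 h4] at hn2
        rcases (show n = S + (a + 1 : ℕ) * (2 * h + 1) + i * (2 * h - 1) + (2 * h - 2) ∨
          (n - (S + (a + 1 : ℕ) * (2 * h + 1) + i * (2 * h - 1))) % 2 = 1 by omega) with h' | h'
        · rcases hi.lt_or_eq with hi | rfl
          · have := R.short_le (Nat.succ_le_of_lt hi)
            rw [show ((i.succ : ℕ) : ℤ) * (2 * h - 1) = i * (2 * h - 1) + (2 * h - 1) by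
              push_cast; ring] at this
            exact this.mem (by omega) (by omega) (by omega) (by omega)
          · have := (hEn S (by omega) (by omega)).1 hS0
            convert this using 1
            omega
        · exact absurd (hB.mem (by omega) (by omega) (by omega) (by omega)) hn1
  refine ⟨hper, fun hiff => ?_, fun p hp hperp => ?_⟩
  · exact hY.notMem (by omega) (by omega) (by omega)
      (hiff.2 (hlast.mem (by omega) (by omega) (by omega) (by omega)))
  · have hpat : ∀ P : ℤ, (∀ n, S - 2 * h - 1 ≤ n → (Z n ↔ Z (n + P))) → ∀ x, S ≤ x →
        ((Z x ∧ ¬ Z (x - 1) ∧ ¬ Z (x - 2) ∧ Z (x - 2 * h - 1) ∧ ¬ Z (x + 2 * h - 2)) ↔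
        (Z (x + P) ∧ ¬ Z (x + P - 1) ∧ ¬ Z (x + P - 2) ∧ Z (x + P - 2 * h - 1) ∧
          ¬ Z (x + P + 2 * h - 2))) := by
      intro P hP x hx
      rw [hP x (by omega), hP (x - 1) (by omega), hP (x - 2) (by omega),
        hP (x - 2 * h - 1) (by omega), hP (x + 2 * h - 2) (by omega)]
      ring_nf
    have hlong := R.long a (by omega)
    have hshort := R.short_le (i := 0) (by omega)
    push_cast at hshort
    rw [add_one_mul (a : ℤ), zero_mul] at hshort
    refine le_of_unique_pattern hp (hpat _ hper) (hpat _ hperp)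
      (x₀ := S + (a + 1 : ℕ) * (2 * h + 1)) (by omega) (by omega) ⟨?_, ?_, ?_, ?_, ?_⟩ ?_
    · exact hshort.mem (by omega) (by omega) (by omega) (by omega)
    · exact hlong.notMem (by omega) (by omega) (by omega)
    · exact hlong.notMem (by omega) (by omega) (by omega)
    · exact hlong.mem (by omega) (by omega) (by omega) (by omega)
    · exact hshort.notMem (by omega) (by omega) (by omega)
    · rintro n h1 h2 ⟨n0, n1, n2, n3, n4⟩
      rcases hcover n h1 h2 with ⟨u, hu, h3, h4, hB⟩ | ⟨i, hi, h3, h4, hB⟩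
      · rw [hB.mem_iff h3 h4] at n0
        rcases (show n = S + u * (2 * h + 1) ∨ S + u * (2 * h + 1) + 2 ≤ n by omega) with h' | h'
        · exact absurd (hB.mem (by omega) (by omega) (by omega) (by omega)) n4
        · exact absurd (hB.mem (by omega) (by omega) (by omega) (by omega)) n2
      · rw [hB.mem_iff h3 h4] at n0
        rcases (show n = S + (a + 1 : ℕ) * (2 * h + 1) + i * (2 * h - 1) ∨
          S + (a + 1 : ℕ) * (2 * h + 1) + i * (2 * h - 1) + 2 ≤ n by omega) with h' | h'
        · rcases (show i = 0 ∨ i = 1 ∨ 2 ≤ i by omega) with rfl | rfl | hi2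
          · simpa using h'
          · push_cast at h'
            rw [add_one_mul (a : ℤ)] at h'
            exact absurd n3 (hlong.notMem (by omega) (by omega) (by omega))
          · obtain ⟨i, rfl⟩ := Nat.exists_eq_add_of_le' hi2
            have := R.short_le (i := i) (by omega)
            rw [show ((i + 2 : ℕ) : ℤ) * (2 * h - 1) =
              i * (2 * h - 1) + (2 * h - 1) + (2 * h - 1) by push_cast; ring] at h'
            exact absurd n3 (this.notMem (by omega) (by omega) (by omega))
        · exact absurd (hB.mem (by omega) (by omega) (by omega) (by omega)) n2

lemma hasPeriodFrom_add (hZ : IsZeroSet (2 * h) c Z) (R : Row Z h S 0 e m) (hm : 1 ≤ m)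
    (hmh : m + 2 ≤ h) (he : 1 ≤ e) (hS : 2 * h + 1 ≤ S)
    (hX : Blk Z (S - 2 * m - 1) (2 * m + 1) m)
    (hY : Blk Z (S - 2 * m - 2 * h) (2 * h - 1) (m - 1))
    (hc : c = e * (2 * h - 1) + 2 * m) :
    HasPeriodFrom Z (S - 2 * h - 1) (2 * h + c) := by
  have hG := R.gap
  have hG0 := R.before_gap (by omega) (by omega)
  have hfirst := R.short 0 (by omega)
  have hepos : 1 * (2 * h - 1) ≤ (e : ℤ) * (2 * h - 1) :=
    mul_le_mul_of_nonneg_right (by exact_mod_cast he) (by omega)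
  have hcS : S + (0 : ℕ) * (2 * h + 1) + e * (2 * h - 1) = S + c - 2 * m := by
    rw [hc]; push_cast; ring
  rw [hcS] at hG hG0
  simp only [Nat.cast_zero, zero_mul, add_zero] at hfirst
  have hstart : ∀ i : ℕ, i ≤ e → Z (S + i * (2 * h - 1)) := by
    intro i hi
    rcases hi.lt_or_eq with hi | rfl
    · have := R.short i hi
      push_cast at this
      exact this.mem (by omega) (by omega) (by omega) (by omega)
    · exact hG.mem (by omega) (by omega) (by omega) (by omega)
  have hT : Blk Z (S + c - 2 * m + (2 * h - 1)) (2 * m + 1) m := by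
    refine Blk.of_step hZ (by omega) (hG.notMem (by omega) (by omega) (by omega))
      (fun t h1 h2 h3 h4 hB => ⟨?_, hfirst.notMem (by omega) (by omega) (by omega)⟩)
      (fun t h3 h4 h5 hB => ?_)
    · rcases (show t = 0 ∨ 1 ≤ t by omega) with rfl | h'
      · convert hG0 using 2; ring
      · exact hG.notMem (by omega) (by omega) (by omega)
    · right; right
      convert hstart 1 he using 1
      push_cast
      omega
  have hcover : ∀ n, S ≤ n → n < S + c - 2 * m →
      (∃ i : ℕ, i < e ∧ S + i * (2 * h - 1) ≤ n ∧ n < S + i * (2 * h - 1) + (2 * h - 1) ∧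
        Blk Z (S + i * (2 * h - 1)) (2 * h - 1) (h - 1)) := by
    intro n h1 h2
    have := R.exists_short (n := n) (by omega) (by push_cast; omega) (by omega)
    simpa using this
  have hlast : ∀ t, 0 ≤ t → t < 2 * h - 2 → t % 2 = 0 →
      Z (S + c - 2 * m - (2 * h - 1) + t) := by
    obtain ⟨e, rfl⟩ := Nat.exists_eq_add_of_le' he
    have := R.short e (by omega)
    push_cast at hc this
    rw [add_one_mul] at hc
    intro t h1 h2 h3
    exact this.mem (by omega) (by omega) (by omega) (by omega)
  have hper : ∀ n, S - 2 * h - 1 ≤ n → (Z n ↔ Z (n + (2 * h + c))) := by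
    refine hZ.periodic_add (S := S) (by omega) (by omega) (by omega) (by omega)
      (fun n h1 h2 => ?_) (fun n h1 h2 hEn hn1 hn2 => ?_)
    · rcases lt_or_ge n (S - 2 * m - 1) with h3 | h3
      · exact iff_of_false (hY.notMem (by omega) (by omega) (by omega))
          (hG.notMem (by omega) (by omega) (by omega))
      · rw [hX.mem_iff (by omega) (by omega), hT.mem_iff (by omega) (by omega)]
        omega
    · rcases lt_or_ge n (S + c - 2 * m) with h3 | h3
      · obtain ⟨i, hi, h4, h5, hB⟩ := hcover n h1 h3
        left
        rw [hB.mem_iff h4 h5] at hn2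
        rcases (show n = S + i * (2 * h - 1) + (2 * h - 2) ∨
          (n - (S + i * (2 * h - 1))) % 2 = 1 by omega) with h' | h'
        · rcases (Nat.succ_le_of_lt hi).lt_or_eq with hi' | rfl
          · convert hstart (i + 2) hi' using 1
            push_cast
            rw [h']
            ring
          · rw [Nat.succ_eq_add_one] at hc
            push_cast at hc
            rw [add_one_mul] at hc
            exact hT.mem (by omega) (by omega) (by omega) (by omega)
        · exact absurd (hB.mem (by omega) (by omega) (by omega) (by omega)) hn1
      · rcases lt_or_ge n (S + c - 2 * m + (2 * h - 1)) with h4 | h4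
        · rw [hG.mem_iff h3 h4] at hn2
          rcases Int.emod_two_eq_zero_or_one (n - (S + c - 2 * m)) with h' | h'
          · left
            have := (hEn (n + 2 * h - (2 * h + c)) (by omega) (by omega)).1
              (hfirst.mem (by omega) (by omega) (by omega) (by omega))
            rwa [sub_add_cancel] at this
          · right
            have hn3 : S + c - 2 * m + 2 * m ≤ n := by
              by_contra! hlt
              exact hn1 (hG.mem (by omega) (by omega) (by omega) (by omega))
            have := (hEn (n - 2 * h) (by omega) (by omega)).1 (by
              convert hlast (n - (S + c - 2 * m) - 1) (by omega) (by omega) (by omega) using 1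
              ring)
            rwa [show n - 2 * h + (2 * h + c) = n + c by ring] at this
        · left
          rw [hT.mem_iff h4 (by omega)] at hn2
          rcases (show n = S + c + (2 * h - 1) ∨
            (n - (S + c - 2 * m + (2 * h - 1))) % 2 = 1 by omega) with h' | h'
          · have := (hEn _ (by omega) (by omega)).1 (hstart 1 he)
            convert this using 1
            push_cast
            omega
          · exact absurd (hT.mem (by omega) (by omega) (by omega) (by omega)) hn1
  refine ⟨hper, fun hiff => ?_, fun p hp hperp => ?_⟩
  · exact hY.notMem (by omega) (by omega) (by omega)
      (hiff.2 (hG.mem (by omega) (by omega) (by omega) (by omega)))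
  · have hpat : ∀ P : ℤ, (∀ n, S - 2 * h - 1 ≤ n → (Z n ↔ Z (n + P))) → ∀ x, S ≤ x →
        ((Z x ∧ ¬ Z (x - 1) ∧ ¬ Z (x - 2) ∧ ¬ Z (x - 3)) ↔
        (Z (x + P) ∧ ¬ Z (x + P - 1) ∧ ¬ Z (x + P - 2) ∧ ¬ Z (x + P - 3))) := by
      intro P hP x hx
      rw [hP x (by omega), hP (x - 1) (by omega), hP (x - 2) (by omega), hP (x - 3) (by omega)]
      ring_nf
    refine le_of_unique_pattern hp (hpat _ hper) (hpat _ hperp)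
      (x₀ := S + c - 2 * m + (2 * h - 1)) (by omega) (by omega) ⟨?_, ?_, ?_, ?_⟩ ?_
    · exact hT.mem (by omega) (by omega) (by omega) (by omega)
    · exact hG.notMem (by omega) (by omega) (by omega)
    · exact hG.notMem (by omega) (by omega) (by omega)
    · exact hG.notMem (by omega) (by omega) (by omega)
    · rintro n h1 h2 ⟨n0, n1, n2, n3⟩
      rcases lt_or_ge n (S + c - 2 * m) with h3 | h3
      · obtain ⟨i, hi, h4, h5, hB⟩ := hcover n h1 h3
        rw [hB.mem_iff h4 h5] at n0
        rcases (show n = S + i * (2 * h - 1) ∨ S + i * (2 * h - 1) + 2 ≤ n by omega) with h' | h'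
        · rcases Nat.eq_zero_or_pos i with rfl | hi0
          · push_cast at h'
            exact absurd (hX.mem (by omega) (by omega) (by omega) (by omega)) n3
          · obtain ⟨i, rfl⟩ := Nat.exists_eq_add_of_le' hi0
            have := R.short i (by omega)
            push_cast at h' this
            rw [add_one_mul] at h'
            exact absurd (this.mem (by omega) (by omega) (by omega) (by omega)) n3
        · exact absurd (hB.mem (by omega) (by omega) (by omega) (by omega)) n2
      · rcases lt_or_ge n (S + c - 2 * m + (2 * h - 1)) with h4 | h4
        · rw [hG.mem_iff h3 h4] at n0
          rcases (show n = S + c - 2 * m ∨ S + c - 2 * m + 2 ≤ n by omega) with h' | h'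
          · refine absurd ?_ n3
            convert hlast (2 * h - 4) (by omega) (by omega) (by omega) using 1
            omega
          · exact absurd (hG.mem (by omega) (by omega) (by omega) (by omega)) n2
        · rw [hT.mem_iff h4 (by omega)] at n0
          by_contra hne
          exact absurd (hT.mem (by omega) (by omega) (by omega) (by omega)) n2

lemma hasPeriodFrom_sub (hZ : IsZeroSet (2 * h) c Z) (R : Row Z h S 0 e (h - 1)) (hh : 2 ≤ h)
    (hS : 2 * h + 1 ≤ S)
    (hX : Blk Z (S - 2 * h + 1) (2 * h - 1) (h - 1))
    (hY : Blk Z (S - 4 * h + 2) (2 * h - 1) (h - 2))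
    (hbc : 2 * h ≤ c) (hc : c = e * (2 * h - 1) + 2 * (h - 1)) :
    HasPeriodFrom Z (S - 2 * h - 1) (2 * h - 1) := by
  have hB : ∀ i : ℕ, i ≤ e + 1 →
      Blk Z (S - 2 * h + 1 + i * (2 * h - 1)) (2 * h - 1) (h - 1) := by
    intro i hi
    rcases Nat.eq_zero_or_pos i with rfl | hi0
    · simpa using hX
    · obtain ⟨i, rfl⟩ := Nat.exists_eq_add_of_le' hi0
      convert R.short_le (i := i) (by omega) using 1
      push_cast
      ring
  have hper : ∀ n, S - 2 * h - 1 ≤ n → (Z n ↔ Z (n + (2 * h - 1))) := by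
    refine hZ.periodic_window (by omega) hbc (by omega) (by omega) fun n h1 h2 => ?_
    rcases lt_or_ge n (S - 2 * h + 1) with h3 | h3
    · exact iff_of_false (hY.notMem (by omega) (by omega) (by omega))
        (hX.notMem (by omega) (by omega) (by omega))
    · obtain ⟨i, hi, h4, h5⟩ := exists_block_of_lt (len := 2 * h - 1) (n := n - (S - 2 * h + 1))
        (q := e + 1) (by omega) (by omega) (by push_cast; rw [add_one_mul]; omega)
      have hB1 := hB i (by omega)
      have hB2 := hB (i + 1) (by omega)
      push_cast at hB2
      rw [add_one_mul] at hB2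
      rw [hB1.mem_iff (by omega) (by omega), hB2.mem_iff (by omega) (by omega)]
      omega
  refine ⟨hper, fun hiff => ?_, fun p hp hperp => ?_⟩
  · exact hY.notMem (by omega) (by omega) (by omega)
      (hiff.2 (hX.mem (by omega) (by omega) (by omega) (by omega)))
  · have hpat : ∀ P : ℤ, (∀ n, S - 2 * h - 1 ≤ n → (Z n ↔ Z (n + P))) → ∀ x, S - 2 * h + 1 ≤ x →
        ((Z x ∧ ¬ Z (x - 1) ∧ ¬ Z (x - 2)) ↔
        (Z (x + P) ∧ ¬ Z (x + P - 1) ∧ ¬ Z (x + P - 2))) := by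
      intro P hP x hx
      rw [hP x (by omega), hP (x - 1) (by omega), hP (x - 2) (by omega)]
      ring_nf
    refine le_of_unique_pattern hp (hpat _ hper) (hpat _ hperp)
      (x₀ := S - 2 * h + 1) (by omega) (by omega) ⟨?_, ?_, ?_⟩ ?_
    · exact hX.mem (by omega) (by omega) (by omega) (by omega)
    · exact hY.notMem (by omega) (by omega) (by omega)
    · exact hY.notMem (by omega) (by omega) (by omega)
    · rintro n h1 h2 ⟨n0, n1, n2⟩
      rw [hX.mem_iff h1 (by omega)] at n0
      by_contra hne
      exact absurd (hX.mem (by omega) (by omega) (by omega) (by omega)) n2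

end Row

end EventualPeriod

lemma IsZeroSet.hasPeriodFrom {c h ρ : ℤ} {Z : ℤ → Prop} {q : ℕ} (hZ : IsZeroSet (2 * h) c Z)
    (hbc : 2 * h ≤ c) (hq : 1 ≤ q) (hρ : 0 ≤ ρ) (hρh : ρ + 2 ≤ h) (hne : 2 ≤ q + ρ)
    (hc : c = q * (2 * h + 1) + 2 * ρ) {M : ℕ} (hM : (M : ℤ) = min (q : ℤ) (h - 1 - ρ)) :
    HasPeriodFrom Z (M * (2 * h + c + 2) - 2 * h - 1)
      (if h - 1 - ρ < q then c + 1 else if q < h - 1 - ρ then 2 * h + c else 2 * h - 1) := by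
  obtain ⟨M, rfl⟩ := Nat.exists_eq_add_of_le' (show 1 ≤ M by omega)
  obtain ⟨a, ha⟩ := Nat.exists_eq_add_of_le' (show M + 1 ≤ q by omega)
  push_cast at hM
  have R := hZ.row hq hρ hne hc (M + 1) a ha.symm (by push_cast; omega)
  have R' := hZ.row hq hρ hne hc M (a + 1) (by omega) (by omega)
  have hpos : 0 ≤ (M : ℤ) * (2 * h + c + 2) := mul_nonneg (by positivity) (by omega)
  have hcR : c = (a + 1 : ℕ) * (2 * h + 1) + M * (2 * h - 1) + 2 * (ρ + M) := by
    rw [hc, ha]; push_cast; ring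
  have hX := R'.tail hZ hpos (by omega) (by omega) (by omega) hcR
  have hY := R'.gap
  rw [show M * (2 * h + c + 2) + (a + 1 : ℕ) * (2 * h + 1) + M * (2 * h - 1) =
    M * (2 * h + c + 2) + c - 2 * (ρ + M) by rw [hcR]; ring] at hY
  push_cast at R hcR ⊢
  rw [add_one_mul] at R ⊢
  rw [add_one_mul] at hcR
  set S : ℤ := M * (2 * h + c + 2) + (2 * h + c + 2) with hS
  split_ifs with h1 h2
  · rw [show ρ + ((M : ℤ) + 1) = h - 1 by omega] at R
    refine R.hasPeriodFrom_succ hZ (by omega) (by omega) (by omega) (by omega) ?_ ?_ ?_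
    · convert hX using 1 <;> omega
    · convert hY using 1 <;> omega
    · push_cast
      rw [add_one_mul]
      omega
  · obtain rfl : a = 0 := by omega
    refine R.hasPeriodFrom_add hZ (by omega) (by omega) (by omega) (by omega) ?_ ?_ ?_
    · convert hX using 1 <;> omega
    · convert hY using 1 <;> omega
    · push_cast at hcR ⊢
      rw [add_one_mul]
      omega
  · obtain rfl : a = 0 := by omega
    rw [show ρ + ((M : ℤ) + 1) = h - 1 by omega] at R
    refine R.hasPeriodFrom_sub hZ (by omega) (by omega) ?_ ?_ hbc ?_
    · convert hX using 1 <;> omega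
    · convert hY using 1 <;> omega
    · push_cast at hcR ⊢
      rw [add_one_mul]
      omega

lemma periodic_nat_mul {w : ℤ → ℕ} {N P : ℤ} (hP : 0 ≤ P) (hw : ∀ n, N ≤ n → w n = w (n + P))
    (k : ℕ) : ∀ n, N ≤ n → w n = w (n + k * P) := by
  induction k with
  | zero => simp
  | succ k ih =>
    intro n hn
    have : 0 ≤ (k : ℤ) * P := by positivity
    rw [ih n hn, hw _ (by omega)]
    push_cast
    ring_nf

/-- Eventual periods hold as early as any given period does. -/
lemma periodic_of_periodicOver {w : ℤ → ℕ} {N : ℤ} {P p : ℕ} (hP : 0 < P)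
    (hw : ∀ n, N ≤ n → w n = w (n + P)) (hp : PeriodicOver w p) :
    ∀ n, N ≤ n → w n = w (n + p) := by
  obtain ⟨K, hK⟩ := hp
  intro n hn
  obtain ⟨k, hk⟩ : ∃ k : ℕ, (K : ℤ) ≤ n + k * P := by
    refine ⟨(K - n).toNat, ?_⟩
    have : ((K - n).toNat : ℤ) * 1 ≤ (K - n).toNat * P :=
      mul_le_mul_of_nonneg_left (by exact_mod_cast hP) (by positivity)
    omega
  rw [periodic_nat_mul (by positivity) hw k n hn, hK _ hk,
    periodic_nat_mul (by positivity) hw k (n + p) (by omega)]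
  ring_nf

lemma preper_eq_zero_of_periodic (A : Set ℕ) {P : ℤ} (hP : 0 < P)
    (hw : ∀ n, 0 ≤ n → (W A one n = 0 ↔ W A one (n + P) = 0)) : preper (W A one) = 0 := by
  lift P to ℕ using hP.le
  have hP' : 0 < P := by exact_mod_cast hP
  have hw' : ∀ n : ℤ, 0 ≤ n → W A one n = W A one (n + P) :=
    fun n hn => (W_congr_iff A _ _).2 (hw n hn)
  have hmem : per (W A one) ∈ {p : ℕ | 0 < p ∧ PeriodicOver (W A one) p} :=
    Nat.sInf_mem ⟨P, hP', 0, by exact_mod_cast hw'⟩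
  refine Nat.sInf_eq_zero.2 (Or.inl fun n hn => ?_)
  exact periodic_of_periodicOver hP' hw' hmem.2 n (by exact_mod_cast hn)

lemma per_preper_of_hasPeriodFrom (A : Set ℕ) {N P : ℕ} (hP : 0 < P)
    (H : HasPeriodFrom (fun n => W A one n = 0) N P) :
    preper (W A one) = N ∧ per (W A one) = P := by
  have hw : ∀ n : ℤ, (N : ℤ) ≤ n → W A one n = W A one (n + P) :=
    fun n hn => (W_congr_iff A _ _).2 (H.periodic n hn)
  have hper : per (W A one) = P := by
    refine le_antisymm (Nat.sInf_le ⟨hP, N, hw⟩) (le_csInf ⟨P, hP, N, hw⟩ fun p hp => ?_)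
    have := H.min p (by exact_mod_cast hp.1) fun n hn =>
      (W_congr_iff A _ _).1 (periodic_of_periodicOver hP hw hp.2 n hn)
    exact_mod_cast this
  refine ⟨?_, hper⟩
  unfold preper
  rw [hper]
  refine le_antisymm (Nat.sInf_le hw) (le_csInf ⟨N, hw⟩ fun K hK => ?_)
  by_contra! hlt
  exact H.pre ((W_congr_iff A _ _).1 (hK (N - 1) (by omega)))

lemma preper_eq_zero_of_not {b c : ℕ} (hb : 1 < b) (hbc : b < c)
    (hn : ¬ (Even b ∧ b + 1 < c ∧ Even (c % (b + 1)) ∧ c % (b + 1) < b - 2)) :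
    preper (W {1, b, c} one) = 0 := by
  have hZ := isZeroSet_W b c (by omega) (by omega)
  rcases Nat.even_or_odd' b with ⟨h, rfl | rfl⟩
  · have hdm := Nat.mod_add_div c (2 * h + 1)
    have hlt := Nat.mod_lt c (show 0 < 2 * h + 1 by omega)
    have hq : 1 ≤ c / (2 * h + 1) := Nat.div_pos (by omega) (by omega)
    generalize c / (2 * h + 1) = q at *
    generalize hr : c % (2 * h + 1) = r at *
    rw [mul_comm] at hdm
    have hc : (c : ℤ) = q * (2 * h + 1) + r := by rw [← hdm]; push_cast; ring
    push_cast at hZ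
    rcases Nat.even_or_odd' r with ⟨ρ, rfl | rfl⟩
    · rcases (show 2 * h + 1 = c ∨ ρ = h ∨ ρ + 1 = h by
        by_contra! h'
        exact hn ⟨even_two_mul h, by omega, even_two_mul ρ, by omega⟩) with h' | rfl | rfl
      · subst h'
        push_cast at hZ
        exact preper_eq_zero_of_periodic _ (by omega) (hZ.pure_of_eq_succ (by omega))
      · exact preper_eq_zero_of_periodic _ (by omega)
          (hZ.pure_of_add_one_eq_mul (by omega) (m := q + 1) (by omega)
            (by rw [hc]; push_cast; ring))
      · push_cast at hZ
        exact preper_eq_zero_of_periodic _ (by omega)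
          (hZ.pure_of_remainder_eq (by omega) hq (by rw [hc]; push_cast; ring))
    · exact preper_eq_zero_of_periodic _ (by omega)
        (hZ.pure_of_odd_remainder (by omega) hq (by omega) (by omega) (by omega) hc)
  · rcases Int.emod_two_eq_zero_or_one c with hc | hc
    · exact preper_eq_zero_of_periodic _ (by omega)
        (hZ.pure_of_odd_even (by omega) hc (by omega) (by omega))
    · exact preper_eq_zero_of_periodic _ (by omega)
        (hZ.pure_of_odd_odd (by omega) hc (by omega) (by omega))

lemma preper_per_eq {b c : ℕ} (hb : Even b) (hbc : b + 1 < c) (hr : Even (c % (b + 1)))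
    (hrb : c % (b + 1) < b - 2) :
    0 < min (c / (b + 1)) ((b - c % (b + 1) - 2) / 2) * (b + c + 2) - b - 1 ∧
    preper (W {1, b, c} one)
      = min (c / (b + 1)) ((b - c % (b + 1) - 2) / 2) * (b + c + 2) - b - 1 ∧
    per (W {1, b, c} one) = if (b - c % (b + 1) - 2) / 2 < c / (b + 1) then c + 1
      else if c / (b + 1) < (b - c % (b + 1) - 2) / 2 then b + c else b - 1 := by
  have hZ := isZeroSet_W b c (by omega) (by omega)
  have hdm := Nat.mod_add_div c (b + 1)
  have hq : 1 ≤ c / (b + 1) := Nat.div_pos (by omega) (by omega)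
  generalize c / (b + 1) = q at *
  generalize c % (b + 1) = r at *
  obtain ⟨h, rfl⟩ := hb.exists_two_nsmul
  obtain ⟨ρ, rfl⟩ := hr.exists_two_nsmul
  simp only [smul_eq_mul] at *
  rw [show (2 * h - 2 * ρ - 2) / 2 = h - 1 - ρ by omega]
  have hne : 2 ≤ q + ρ := by
    by_contra! hlt
    obtain rfl : q = 1 := by omega
    omega
  obtain ⟨M, hM⟩ : ∃ M, M = min q (h - 1 - ρ) := ⟨_, rfl⟩
  rw [← hM]
  have hMpos : 1 * (2 * h + c + 2) ≤ M * (2 * h + c + 2) :=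
    Nat.mul_le_mul_right _ (by omega)
  push_cast at hZ
  have H := hZ.hasPeriodFrom (ρ := ρ) (q := q) (M := M) (by omega) hq (by omega) (by omega)
    (by omega) (by rw [← hdm]; push_cast; ring) (by omega)
  refine ⟨by omega, per_preper_of_hasPeriodFrom _ (by split_ifs <;> omega) ?_⟩
  convert H using 1
  · rw [Nat.cast_sub (by omega), Nat.cast_sub (by omega)]
    push_cast
    ring
  · split_ifs <;> push_cast <;> omega

/-- for `A = {1,b,c}` with `1 < b < c`, `q = ⌊c/(b+1)⌋`,
`r = c mod (b+1)`: `preper(A) > 0` iff `b` even, `c > b+1`, `r` even with `r < b-2`;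
and in that case, with `γ = (b-r-2)/2`, `preper(A) = min(q,γ)(b+c+2) - b - 1` and
`per(A) = c+1`, `b+c`, or `b-1` according as `γ < q`, `q < γ`, or `q = γ`. -/
theorem stmt_16 (b c : ℕ) (hb : 1 < b) (hbc : b < c) :
    (0 < preper (W {1, b, c} one) ↔
      (Even b ∧ b + 1 < c ∧ Even (c % (b + 1)) ∧ c % (b + 1) < b - 2)) ∧
    ((Even b ∧ b + 1 < c ∧ Even (c % (b + 1)) ∧ c % (b + 1) < b - 2) →
      (preper (W {1, b, c} one)
          = min (c / (b + 1)) ((b - c % (b + 1) - 2) / 2) * (b + c + 2) - b - 1 ∧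
       ((b - c % (b + 1) - 2) / 2 < c / (b + 1) → per (W {1, b, c} one) = c + 1) ∧
       (c / (b + 1) < (b - c % (b + 1) - 2) / 2 → per (W {1, b, c} one) = b + c) ∧
       (c / (b + 1) = (b - c % (b + 1) - 2) / 2 → per (W {1, b, c} one) = b - 1))) := by
  refine ⟨⟨fun h => ?_, fun ⟨h1, h2, h3, h4⟩ => ?_⟩, fun ⟨h1, h2, h3, h4⟩ => ?_⟩
  · by_contra hn
    exact h.ne' (preper_eq_zero_of_not hb hbc hn)
  · obtain ⟨hpos, hpre, -⟩ := preper_per_eq h1 h2 h3 h4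
    rwa [hpre]
  · obtain ⟨-, hpre, hper⟩ := preper_per_eq h1 h2 h3 h4
    refine ⟨hpre, fun h => ?_, fun h => ?_, fun h => ?_⟩
    · rw [hper, if_pos h]
    · rw [hper, if_neg h.asymm, if_pos h]
    · rw [hper, if_neg h.not_gt, if_neg h.not_lt]
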